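/- Let p ≥ 3 and (β,h) be a p-critical point, and denote the K global maximizers of H = H_{β,h,p} by m_1 < ⋯ < m_K. Then K ∈ {2,3}, and if X ~ P_{β,h,p}, then as N → ∞ the empirical magnetization S_N/N converges in distribution to the discrete measure Σ_{k=1}^K p_k δ_{m_k}, where p_k := [(m_k² − 1) H''(m_k)]^{−1/2} / Σ_{i=1}^K [(m_i² − 1) H''(m_i)]^{−1/2}. -/

import Mathlib

open Real MeasureTheory Filter
open scoped BigOperators Topology

noncomputable section

/-- The spin value (`±1`) of a Boolean coordinate. -/
def spin (b : Bool) : ℝ := if b then 1 else -1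

/-- The total magnetization `S_N = ∑ᵢ Xᵢ` of a configuration. -/
def mag {N : ℕ} (x : Fin N → Bool) : ℝ := ∑ i, spin (x i)

/-- The Hamiltonian of the `p`-spin Curie-Weiss model:
`β N^{1-p} ∑_{i₁,…,i_p} x_{i₁} ⋯ x_{i_p} + h ∑ᵢ xᵢ`. -/
def cwHamiltonian (p N : ℕ) (β h : ℝ) (x : Fin N → Bool) : ℝ :=
  β * (N : ℝ) ^ ((1 : ℤ) - (p : ℤ)) * (∑ i : Fin p → Fin N, ∏ j, spin (x (i j)))
    + h * mag x

/-- The (unnormalized) Gibbs weight of a configuration. -/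
def cwWeight (p N : ℕ) (β h : ℝ) (x : Fin N → Bool) : ℝ :=
  Real.exp (cwHamiltonian p N β h x)

/-- The probability of an event `E` under the `p`-spin Curie-Weiss measure `P_{β,h,p}`. -/
def cwProb (p N : ℕ) (β h : ℝ) (E : Set (Fin N → Bool)) : ℝ :=
  (∑ x : Fin N → Bool, E.indicator (cwWeight p N β h) x) /
    ∑ x : Fin N → Bool, cwWeight p N β h x

/-- Conditional probability of `E` given `A` under the `p`-spin Curie-Weiss measure. -/
def cwCondProb (p N : ℕ) (β h : ℝ) (E A : Set (Fin N → Bool)) : ℝ :=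
  cwProb p N β h (E ∩ A) / cwProb p N β h A

/-- The binary entropy function `I(x) = ½[(1+x)log(1+x) + (1-x)log(1-x)]`. -/
def binEnt (x : ℝ) : ℝ := (1/2) * ((1+x) * Real.log (1+x) + (1-x) * Real.log (1-x))

/-- The function `H_{β,h,p}(x) = βxᵖ + hx - I(x)`. -/
def Hfun (p : ℕ) (β h : ℝ) (x : ℝ) : ℝ := β * x ^ p + h * x - binEnt x

/-- `m` is a global maximizer of `H_{β,h,p}` on `[-1,1]`, lying in `(-1,1)`. -/
def isMaximizer (p : ℕ) (β h m : ℝ) : Prop :=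
  m ∈ Set.Ioo (-1 : ℝ) 1 ∧ ∀ x ∈ Set.Icc (-1 : ℝ) 1, Hfun p β h x ≤ Hfun p β h m

/-- `m` is the unique global maximizer of `H_{β,h,p}`. -/
def isUniqueMaximizer (p : ℕ) (β h m : ℝ) : Prop :=
  isMaximizer p β h m ∧ ∀ m', isMaximizer p β h m' → m' = m

/-- `(β,h)` is a `p`-regular point with unique global maximizer `m`. -/
def pRegular (p : ℕ) (β h m : ℝ) : Prop :=
  isUniqueMaximizer p β h m ∧ iteratedDeriv 2 (Hfun p β h) m < 0

/-- `(β,h)` is a `p`-special point with unique global maximizer `m`. -/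
def pSpecial (p : ℕ) (β h m : ℝ) : Prop :=
  isUniqueMaximizer p β h m ∧ iteratedDeriv 2 (Hfun p β h) m = 0

/-- `(β,h)` is a `p`-critical point: `H_{β,h,p}` has more than one global maximizer. -/
def pCritical (p : ℕ) (β h : ℝ) : Prop :=
  ∃ m₁ m₂, m₁ ≠ m₂ ∧ isMaximizer p β h m₁ ∧ isMaximizer p β h m₂

/-- The probability assigned to a set `S ⊆ ℝ` by the centered Gaussian with variance `v`. -/
def gaussProb (v : ℝ) (S : Set ℝ) : ℝ :=
  ∫ t in S, (Real.sqrt (2 * Real.pi * v))⁻¹ * Real.exp (-t ^ 2 / (2 * v))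

/-- The CDF of the centered Gaussian with variance `v`. -/
def gaussCDF (v x : ℝ) : ℝ := gaussProb v (Set.Iic x)

/-- The standard normal CDF `Φ`. -/
def stdNormCDF (x : ℝ) : ℝ := gaussCDF 1 x

/-- The CDF of the limit law `F` at a `p`-special point, where `c = H⁽⁴⁾(m_*)`:
`dF(x) = (2/Γ(1/4)) (-c/24)^{1/4} exp(c x⁴/24) dx`. -/
def specialCDF (c x : ℝ) : ℝ :=
  ∫ t in Set.Iic x, (2 / Real.Gamma (1/4)) * ((-c) / 24) ^ ((1:ℝ)/4) * Real.exp (c * t ^ 4 / 24)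

/-- The inverse hyperbolic tangent `tanh⁻¹(t) = ½ log((1+t)/(1-t))`. -/
def arctanh (t : ℝ) : ℝ := (1/2) * Real.log ((1+t)/(1-t))

/-- The function `g(t) = tanh⁻¹(t)/(p t^{p-1})`, so that the maximum pseudolikelihood
estimate of `β` is `g(X̄)`. -/
def gMPL (p : ℕ) (t : ℝ) : ℝ := arctanh t / (p * t ^ (p - 1))

/-- The threshold `β*(p) = inf{β ≥ 0 : sup_{x∈[0,1]} H_{β,0,p}(x) > 0}`. -/
def betaStar (p : ℕ) : ℝ := sInf {b : ℝ | 0 ≤ b ∧ ∃ x ∈ Set.Icc (0:ℝ) 1, 0 < Hfun p b 0 x}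

/-- The first derivative of `Hfun` on `(-1, 1)`. -/
def Hderiv (p : ℕ) (β h x : ℝ) : ℝ :=
  β * (p * x ^ (p - 1)) + h - (1/2) * (Real.log (1 + x) - Real.log (1 - x))

/-- The second derivative of `Hfun` on `(-1, 1)`. -/
def Hderiv2 (p : ℕ) (β x : ℝ) : ℝ :=
  β * (p * (((p - 1 : ℕ) : ℝ) * x ^ (p - 2))) - 1 / (1 - x ^ 2)

lemma hasDerivAt_binEnt {x : ℝ} (hx : x ∈ Set.Ioo (-1 : ℝ) 1) :
    HasDerivAt binEnt ((1/2) * (Real.log (1 + x) - Real.log (1 - x))) x := by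
  have h1 : 1 + x ≠ 0 := by linarith [hx.1]
  have h2 : 1 - x ≠ 0 := by linarith [hx.2]
  have d1 : HasDerivAt (fun y : ℝ => 1 + y) 1 x := (hasDerivAt_id x).const_add 1
  have d2 : HasDerivAt (fun y : ℝ => 1 - y) (-1) x := (hasDerivAt_id x).const_sub 1
  have := ((d1.mul (d1.log h1)).add (d2.mul (d2.log h2))).const_mul (1/2 : ℝ)
  refine this.congr_deriv ?_
  field_simp
  ring

lemma hasDerivAt_Hfun (p : ℕ) (β h : ℝ) {x : ℝ} (hx : x ∈ Set.Ioo (-1 : ℝ) 1) :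
    HasDerivAt (Hfun p β h) (Hderiv p β h x) x := by
  have := (((hasDerivAt_pow p x).const_mul β).add ((hasDerivAt_id x).const_mul h)).sub
    (hasDerivAt_binEnt hx)
  refine this.congr_deriv ?_
  simp [Hderiv]

lemma hasDerivAt_Hderiv (p : ℕ) (β h : ℝ) {x : ℝ} (hx : x ∈ Set.Ioo (-1 : ℝ) 1) :
    HasDerivAt (Hderiv p β h) (Hderiv2 p β x) x := by
  have h1 : 1 + x ≠ 0 := by linarith [hx.1]
  have h2 : 1 - x ≠ 0 := by linarith [hx.2]
  have h3 : 1 - x ^ 2 ≠ 0 := by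
    have : 1 - x ^ 2 = (1 + x) * (1 - x) := by ring
    rw [this]; exact mul_ne_zero h1 h2
  have d1 : HasDerivAt (fun y : ℝ => 1 + y) 1 x := (hasDerivAt_id x).const_add 1
  have d2 : HasDerivAt (fun y : ℝ => 1 - y) (-1) x := (hasDerivAt_id x).const_sub 1
  have := ((((hasDerivAt_pow (p - 1) x).const_mul (p : ℝ)).const_mul β).add_const h).sub
    (((d1.log h1).sub (d2.log h2)).const_mul (1/2 : ℝ))
  refine this.congr_deriv ?_
  have e : p - 1 - 1 = p - 2 := by omega
  simp only [Hderiv2, e]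
  congr 1
  field_simp
  ring

lemma iteratedDeriv_two_Hfun (p : ℕ) (β h : ℝ) {x : ℝ} (hx : x ∈ Set.Ioo (-1 : ℝ) 1) :
    iteratedDeriv 2 (Hfun p β h) x = Hderiv2 p β x := by
  rw [iteratedDeriv_succ, iteratedDeriv_one]
  have : deriv (Hfun p β h) =ᶠ[𝓝 x] Hderiv p β h := by
    filter_upwards [isOpen_Ioo.mem_nhds hx] with y hy using (hasDerivAt_Hfun p β h hy).deriv
  rw [this.deriv_eq, (hasDerivAt_Hderiv p β h hx).deriv]

lemma continuous_binEnt : Continuous binEnt := by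
  have c1 : Continuous fun x : ℝ => (1 + x) * Real.log (1 + x) :=
    Real.continuous_mul_log.comp (by fun_prop : Continuous fun x : ℝ => 1 + x)
  have c2 : Continuous fun x : ℝ => (1 - x) * Real.log (1 - x) :=
    Real.continuous_mul_log.comp (by fun_prop : Continuous fun x : ℝ => 1 - x)
  exact continuous_const.mul (c1.add c2)

lemma continuous_Hfun (p : ℕ) (β h : ℝ) : Continuous (Hfun p β h) := by
  unfold Hfun
  exact (by fun_prop : Continuous fun x : ℝ => β * x ^ p + h * x).sub continuous_binEnt

lemma binEnt_neg (x : ℝ) : binEnt (-x) = binEnt x := by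
  unfold binEnt
  rw [sub_neg_eq_add, ← sub_eq_add_neg, add_comm]

lemma Hfun_lt_Hfun_neg {p : ℕ} {β h x : ℝ} (hβ : 0 < β) (hh : 0 < h) (hx : x < 0) :
    Hfun p β h x < Hfun p β h (-x) := by
  unfold Hfun
  rw [binEnt_neg]
  have h1 : x ^ p ≤ (-x) ^ p := by
    calc x ^ p ≤ |x ^ p| := le_abs_self _
      _ = (-x) ^ p := by rw [abs_pow, abs_of_neg hx]
  nlinarith [mul_le_mul_of_nonneg_left h1 hβ.le, mul_pos hh (neg_pos.2 hx)]

lemma Hderiv_eq_zero_of_isMaximizer {p : ℕ} {β h m : ℝ} (hm : isMaximizer p β h m) :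
    Hderiv p β h m = 0 := by
  refine IsLocalMax.hasDerivAt_eq_zero ?_ (hasDerivAt_Hfun p β h hm.1)
  filter_upwards [isOpen_Ioo.mem_nhds hm.1] with y hy using hm.2 y (Set.Ioo_subset_Icc_self hy)

lemma isMaximizer.pos {p : ℕ} (hp : 3 ≤ p) {β h m : ℝ} (hβ : 0 < β) (hh : 0 < h)
    (hm : isMaximizer p β h m) : 0 < m := by
  rcases lt_trichotomy m 0 with h0 | h0 | h0
  · have := hm.2 (-m) ⟨by linarith [hm.1.2], by linarith [hm.1.1]⟩
    exact absurd (Hfun_lt_Hfun_neg (p := p) hβ hh h0) (not_lt.2 this)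
  · have := Hderiv_eq_zero_of_isMaximizer hm
    have e : p - 1 ≠ 0 := by omega
    simp [Hderiv, h0, e] at this
    exact absurd this hh.ne'
  · exact h0

/-- The maximum of `Hfun` over `[-1, 1]` is never attained at `1`. -/
lemma exists_Hfun_one_lt (p : ℕ) (β h : ℝ) :
    ∃ x ∈ Set.Ioo (0 : ℝ) 1, Hfun p β h 1 < Hfun p β h x := by
  have hlog : Tendsto (fun x : ℝ => Real.log (1 - x)) (𝓝[<] 1) atBot := by
    refine Real.tendsto_log_nhdsGT_zero.comp ?_
    refine tendsto_nhdsWithin_iff.2 ⟨?_, ?_⟩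
    · have : Tendsto (fun x : ℝ => 1 - x) (𝓝 1) (𝓝 (1 - 1)) :=
        (by fun_prop : Continuous fun x : ℝ => 1 - x).tendsto 1
      rw [sub_self] at this
      exact this.mono_left nhdsWithin_le_nhds
    · filter_upwards [self_mem_nhdsWithin] with x hx
      exact sub_pos.2 (Set.mem_Iio.1 hx)
  have hc : Tendsto (fun x : ℝ => β * (p * x ^ (p - 1)) + h - (1/2) * Real.log (1 + x))
      (𝓝[<] 1) (𝓝 (β * (p * 1 ^ (p - 1)) + h - (1/2) * Real.log (1 + 1))) := by
    refine (ContinuousAt.tendsto ?_).mono_left nhdsWithin_le_nhds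
    have : ContinuousAt (fun x : ℝ => Real.log (1 + x)) 1 :=
      ContinuousAt.log (by fun_prop) (by norm_num)
    fun_prop
  have hd : Tendsto (Hderiv p β h) (𝓝[<] 1) atBot := by
    refine (hc.add_atBot (hlog.const_mul_atBot (by norm_num : (0:ℝ) < 1/2))).congr ?_
    intro x; simp only [Hderiv]; ring
  have hneg := hd.eventually (eventually_lt_atBot 0)
  obtain ⟨l, hl, hl'⟩ := (mem_nhdsLT_iff_exists_Ioo_subset).1 hneg
  have hx0 : max l 0 < (max l 0 + 1) / 2 := by
    have : max l 0 < 1 := max_lt hl one_pos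
    linarith
  have hx1 : (max l 0 + 1) / 2 < 1 := by
    have : max l 0 < 1 := max_lt hl one_pos
    linarith
  set x := (max l 0 + 1) / 2 with hxdef
  have hx00 : 0 < x := lt_of_le_of_lt (le_max_right _ _) hx0
  have hlx : l < x := lt_of_le_of_lt (le_max_left _ _) hx0
  refine ⟨x, ⟨hx00, hx1⟩, ?_⟩
  have hanti : StrictAntiOn (Hfun p β h) (Set.Icc x 1) := by
    refine strictAntiOn_of_deriv_neg (convex_Icc _ _) (continuous_Hfun p β h).continuousOn ?_
    intro y hy
    rw [interior_Icc] at hy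
    rw [(hasDerivAt_Hfun p β h ⟨by linarith [hy.1], hy.2⟩).deriv]
    exact hl' ⟨hlx.trans hy.1, hy.2⟩
  exact hanti ⟨le_rfl, hx1.le⟩ ⟨hx1.le, le_rfl⟩ hx1

/-- A maximizer over `[-1, 1]` in the closed interval lies in the open interval. -/
lemma isMaximizer_of_mem_Icc {p : ℕ} {β h m : ℝ} (hβ : 0 < β) (hh : 0 < h)
    (hm : m ∈ Set.Icc (-1 : ℝ) 1)
    (hmax : ∀ x ∈ Set.Icc (-1 : ℝ) 1, Hfun p β h x ≤ Hfun p β h m) : isMaximizer p β h m := by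
  refine ⟨⟨lt_of_le_of_ne hm.1 ?_, lt_of_le_of_ne hm.2 ?_⟩, hmax⟩
  · rintro rfl
    have h1 := Hfun_lt_Hfun_neg (p := p) (β := β) (h := h) hβ hh (x := -1) (by norm_num)
    have := hmax (-(-1)) (by norm_num)
    linarith
  · rintro rfl
    obtain ⟨x, hx, hlt⟩ := exists_Hfun_one_lt p β h
    have := hmax x ⟨by linarith [hx.1], hx.2.le⟩
    linarith

/-- The logarithm of the ratio of the two terms of `Hderiv2`. -/
def logRatio (p : ℕ) (β x : ℝ) : ℝ :=
  Real.log (β * p * ((p - 1 : ℕ) : ℝ)) + ((p - 2 : ℕ) : ℝ) * Real.log x + Real.log (1 - x ^ 2)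

lemma strictConcaveOn_logRatio {p : ℕ} (hp : 3 ≤ p) (β : ℝ) :
    StrictConcaveOn ℝ (Set.Ioo (0 : ℝ) 1) (logRatio p β) := by
  have hd : ∀ x ∈ Set.Ioo (0 : ℝ) 1,
      HasDerivAt (logRatio p β) (((p - 2 : ℕ) : ℝ) / x - 2 * x / (1 - x ^ 2)) x := by
    intro x hx
    have h3 : 1 - x ^ 2 ≠ 0 := by nlinarith [hx.1, hx.2]
    have d2 : HasDerivAt (fun y : ℝ => 1 - y ^ 2) (-(2 * x)) x := by
      simpa using (hasDerivAt_pow 2 x).const_sub 1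
    have := (((Real.hasDerivAt_log hx.1.ne').const_mul ((p - 2 : ℕ) : ℝ)).const_add
      (Real.log (β * p * ((p - 1 : ℕ) : ℝ)))).add (d2.log h3)
    refine this.congr_deriv ?_
    ring
  have hp2 : (0 : ℝ) < ((p - 2 : ℕ) : ℝ) := by exact_mod_cast (by omega : 0 < p - 2)
  refine StrictAntiOn.strictConcaveOn_of_deriv (convex_Ioo _ _)
    (fun x hx => (hd x hx).continuousAt.continuousWithinAt) ?_
  rw [interior_Ioo]
  intro x hx y hy hxy
  rw [(hd x hx).deriv, (hd y hy).deriv]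
  have h3 : 0 < 1 - x ^ 2 := by nlinarith [hx.1, hx.2]
  have h4 : 0 < 1 - y ^ 2 := by nlinarith [hy.1, hy.2]
  have i1 : ((p - 2 : ℕ) : ℝ) / y < ((p - 2 : ℕ) : ℝ) / x := div_lt_div_of_pos_left hp2 hx.1 hxy
  have i2 : 2 * x / (1 - x ^ 2) < 2 * y / (1 - y ^ 2) := by
    refine div_lt_div₀' (by linarith) ?_ (by linarith [hy.1]) h4
    nlinarith [hx.1, hx.2, hy.1]
  linarith

lemma Hderiv2_eq_exp_logRatio {p : ℕ} (hp : 3 ≤ p) {β x : ℝ} (hβ : 0 < β) (hx : x ∈ Set.Ioo (0 : ℝ) 1) :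
    Hderiv2 p β x = (Real.exp (logRatio p β x) - 1) / (1 - x ^ 2) := by
  have h3 : 0 < 1 - x ^ 2 := by nlinarith [hx.1, hx.2]
  have h1 : (0 : ℝ) < ((p - 1 : ℕ) : ℝ) := by exact_mod_cast (by omega : 0 < p - 1)
  have h0 : (0 : ℝ) < (p : ℝ) := by exact_mod_cast (by omega : 0 < p)
  unfold logRatio Hderiv2
  rw [Real.exp_add, Real.exp_add, Real.exp_log (by positivity), Real.exp_log h3,
    ← Real.log_pow, Real.exp_log (pow_pos hx.1 _)]
  field_simp

lemma logRatio_eq_zero_of_Hderiv2_eq_zero {p : ℕ} (hp : 3 ≤ p) {β x : ℝ} (hβ : 0 < β)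
    (hx : x ∈ Set.Ioo (0 : ℝ) 1) (h0 : Hderiv2 p β x = 0) : logRatio p β x = 0 := by
  have h3 : 0 < 1 - x ^ 2 := by nlinarith [hx.1, hx.2]
  rw [Hderiv2_eq_exp_logRatio hp hβ hx, div_eq_zero_iff] at h0
  rcases h0 with h0 | h0
  · exact Real.exp_eq_one_iff _ |>.1 (by linarith)
  · exact absurd h0 h3.ne'

lemma Hderiv2_neg_of_logRatio_neg {p : ℕ} (hp : 3 ≤ p) {β x : ℝ} (hβ : 0 < β)
    (hx : x ∈ Set.Ioo (0 : ℝ) 1) (h0 : logRatio p β x < 0) : Hderiv2 p β x < 0 := by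
  have h3 : 0 < 1 - x ^ 2 := by nlinarith [hx.1, hx.2]
  rw [Hderiv2_eq_exp_logRatio hp hβ hx]
  exact div_neg_of_neg_of_pos (by linarith [(Real.exp_lt_one_iff.2 h0 : Real.exp _ < 1)]) h3

/-- Between two maximizers the second derivative vanishes twice. -/
lemma exists_two_inflections {p : ℕ} (hp : 3 ≤ p) {β h a b : ℝ} (hβ : 0 < β) (hh : 0 < h)
    (ha : isMaximizer p β h a) (hb : isMaximizer p β h b) (hab : a < b) :
    ∃ u v, a < u ∧ u < v ∧ v < b ∧ logRatio p β u = 0 ∧ logRatio p β v = 0 := by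
  have ha0 := ha.pos hp hβ hh
  have hin : ∀ y ∈ Set.Icc a b, y ∈ Set.Ioo (-1 : ℝ) 1 :=
    fun y hy => ⟨by linarith [hy.1], by linarith [hy.2, hb.1.2]⟩
  have hcont : ContinuousOn (Hderiv p β h) (Set.Icc a b) := fun y hy =>
    (hasDerivAt_Hderiv p β h (hin y hy)).continuousAt.continuousWithinAt
  have heq : Hfun p β h a = Hfun p β h b :=
    le_antisymm (hb.2 a (Set.Ioo_subset_Icc_self ha.1)) (ha.2 b (Set.Ioo_subset_Icc_self hb.1))
  obtain ⟨c, hc, hc0⟩ := exists_hasDerivAt_eq_zero hab (continuous_Hfun p β h).continuousOn heq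
    (fun y hy => hasDerivAt_Hfun p β h (hin y (Set.Ioo_subset_Icc_self hy)))
  obtain ⟨u, hu, hu0⟩ := exists_hasDerivAt_eq_zero hc.1
    (hcont.mono (Set.Icc_subset_Icc_right hc.2.le))
    ((Hderiv_eq_zero_of_isMaximizer ha).trans hc0.symm)
    (fun y hy => hasDerivAt_Hderiv p β h (hin y ⟨hy.1.le, hy.2.le.trans hc.2.le⟩))
  obtain ⟨v, hv, hv0⟩ := exists_hasDerivAt_eq_zero hc.2
    (hcont.mono (Set.Icc_subset_Icc_left hc.1.le))
    (hc0.trans (Hderiv_eq_zero_of_isMaximizer hb).symm)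
    (fun y hy => hasDerivAt_Hderiv p β h (hin y ⟨hc.1.le.trans hy.1.le, hy.2.le⟩))
  refine ⟨u, v, hu.1, hu.2.trans hv.1, hv.2, ?_, ?_⟩
  · exact logRatio_eq_zero_of_Hderiv2_eq_zero hp hβ
      ⟨ha0.trans hu.1, by linarith [hu.2, hc.2, hb.1.2]⟩ hu0
  · exact logRatio_eq_zero_of_Hderiv2_eq_zero hp hβ
      ⟨by linarith [hv.1, hc.1], hv.2.trans hb.1.2⟩ hv0

lemma min_logRatio_lt {p : ℕ} (hp : 3 ≤ p) {β x y z : ℝ} (hx : 0 < x) (hxy : x < y) (hyz : y < z)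
    (hz : z < 1) : min (logRatio p β x) (logRatio p β z) < logRatio p β y := by
  refine (strictConcaveOn_logRatio hp β).lt_on_openSegment ⟨hx, by linarith⟩ ⟨by linarith, hz⟩
    (by linarith) ?_
  rw [openSegment_eq_Ioo (hxy.trans hyz)]
  exact ⟨hxy, hyz⟩

lemma Hderiv2_neg_of_two_isMaximizer {p : ℕ} (hp : 3 ≤ p) {β h a b : ℝ} (hβ : 0 < β) (hh : 0 < h)
    (ha : isMaximizer p β h a) (hb : isMaximizer p β h b) (hab : a < b) :
    Hderiv2 p β a < 0 ∧ Hderiv2 p β b < 0 := by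
  obtain ⟨u, v, hau, huv, hvb, hu, hv⟩ := exists_two_inflections hp hβ hh ha hb hab
  have ha0 := ha.pos hp hβ hh
  constructor
  · refine Hderiv2_neg_of_logRatio_neg hp hβ ⟨ha0, ha.1.2⟩ ?_
    have := min_logRatio_lt (β := β) hp ha0 hau huv (hvb.trans hb.1.2)
    rw [hu, hv] at this
    simpa using this
  · refine Hderiv2_neg_of_logRatio_neg hp hβ ⟨ha0.trans hab, hb.1.2⟩ ?_
    have := min_logRatio_lt (β := β) hp (ha0.trans hau) huv hvb hb.1.2
    rw [hu, hv] at this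
    simpa using this

lemma not_three_isMaximizer {p : ℕ} (hp : 3 ≤ p) {β h a b c : ℝ} (hβ : 0 < β) (hh : 0 < h)
    (ha : isMaximizer p β h a) (hb : isMaximizer p β h b) (hc : isMaximizer p β h c)
    (hab : a < b) (hbc : b < c) : False := by
  obtain ⟨u, v, hau, huv, hvb, hu, hv⟩ := exists_two_inflections hp hβ hh ha hb hab
  obtain ⟨u', v', hbu', huv', hvc', hu', hv'⟩ := exists_two_inflections hp hβ hh hb hc hbc
  have := min_logRatio_lt (β := β) hp ((ha.pos hp hβ hh).trans hau) huv (hvb.trans hbu')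
    ((huv'.trans hvc').trans hc.1.2)
  rw [hu, hv, hu'] at this
  simp at this

/-- Sums over configurations of a function of the magnetization, grouped by the number of
`+1` spins. -/
lemma sum_config_eq_sum_choose (N : ℕ) (f : ℝ → ℝ) :
    ∑ σ : Fin N → Bool, f (mag σ) =
      ∑ k ∈ Finset.range (N + 1), (N.choose k : ℝ) * f (2 * k - N) := by
  have h := Finset.sum_powerset_apply_card (fun k : ℕ => f (2 * k - N))
    (x := (Finset.univ : Finset (Fin N)))
  simp only [Finset.card_univ, Fintype.card_fin, nsmul_eq_mul] at h
  rw [← h]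
  refine Finset.sum_bij' (fun σ _ => Finset.univ.filter fun i => σ i = true)
    (fun s _ => fun i => decide (i ∈ s)) ?_ ?_ ?_ ?_ ?_
  · intro σ _; simp
  · intro s _; simp
  · intro σ _; ext i; simp
  · intro s _; ext i; simp
  · intro σ _
    congr 1
    have e : ∀ b : Bool, spin b = 2 * (if b = true then (1 : ℝ) else 0) - 1 := by
      intro b; cases b <;> simp [spin]; norm_num
    simp only [mag, e, Finset.sum_sub_distrib, ← Finset.mul_sum, Finset.sum_boole]
    simp

lemma cwWeight_eq (p : ℕ) {N : ℕ} (hN : N ≠ 0) (β h : ℝ) (σ : Fin N → Bool) :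
    cwWeight p N β h σ =
      Real.exp (N * (β * (mag σ / N) ^ p + h * (mag σ / N))) := by
  have hN' : (N : ℝ) ≠ 0 := by exact_mod_cast hN
  unfold cwWeight cwHamiltonian
  rw [← Fintype.sum_pow (fun i => spin (σ i)) p, zpow_sub₀ hN', zpow_one, zpow_natCast]
  congr 1
  change β * (N / N ^ p) * mag σ ^ p + h * mag σ = _
  rw [div_pow]
  field_simp

/-- The magnetization per site when `k` of the `N` spins are `+1`. -/
def magAt (N k : ℕ) : ℝ := (2 * k - N) / N

/-- The total Gibbs weight of the configurations with `k` spins equal to `+1`, normalized by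
`2 ^ N * exp (N * M)`. -/
def levelWeight (p : ℕ) (β h M : ℝ) (N k : ℕ) : ℝ :=
  N.choose k / 2 ^ N * Real.exp (N * (β * magAt N k ^ p + h * magAt N k) - N * M)

/-- The normalized Gibbs mass of the levels whose magnetization lies in `S`. -/
def levelMass (p : ℕ) (β h M : ℝ) (N : ℕ) (S : Set ℝ) : ℝ :=
  ∑ k ∈ Finset.range (N + 1), S.indicator (fun _ => levelWeight p β h M N k) (magAt N k)

lemma sum_indicator_cwWeight (p : ℕ) {N : ℕ} (hN : N ≠ 0) (β h M : ℝ) (S : Set ℝ) :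
    ∑ σ : Fin N → Bool, {σ | mag σ / N ∈ S}.indicator (cwWeight p N β h) σ =
      2 ^ N * Real.exp (N * M) * levelMass p β h M N S := by
  classical
  have h1 := sum_config_eq_sum_choose N (fun y => S.indicator
    (fun y => Real.exp (N * (β * y ^ p + h * y))) (y / N))
  unfold levelMass
  rw [Finset.mul_sum]
  refine Eq.trans ?_ (h1.trans ?_)
  · refine Finset.sum_congr rfl fun σ _ => ?_
    simp only [Set.indicator_apply, Set.mem_ofPred_eq, cwWeight_eq p hN]
  · refine Finset.sum_congr rfl fun k _ => ?_
    simp only [Set.indicator_apply, levelWeight, magAt]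
    split_ifs with hS
    · rw [Real.exp_sub]
      field_simp
    · simp

lemma cwProb_eq_div (p : ℕ) {N : ℕ} (hN : N ≠ 0) (β h M x : ℝ) :
    cwProb p N β h {σ | mag σ / N ≤ x} =
      levelMass p β h M N (Set.Iic x) / levelMass p β h M N Set.univ := by
  have h1 := sum_indicator_cwWeight p hN β h M (Set.Iic x)
  have h2 := sum_indicator_cwWeight p hN β h M Set.univ
  simp only [Set.mem_univ, Set.ofPred_true, Set.indicator_univ] at h2
  unfold cwProb
  rw [h2]
  simp only [Set.mem_Iic] at h1
  rw [h1, mul_div_mul_left]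
  positivity

lemma one_add_magAt {N : ℕ} (hN : N ≠ 0) (k : ℕ) : 1 + magAt N k = 2 * k / N := by
  have hN' : (N : ℝ) ≠ 0 := by exact_mod_cast hN
  unfold magAt; field_simp; ring

lemma one_sub_magAt {N : ℕ} (hN : N ≠ 0) {k : ℕ} (hk : k ≤ N) :
    1 - magAt N k = 2 * ((N - k : ℕ) : ℝ) / N := by
  have hN' : (N : ℝ) ≠ 0 := by exact_mod_cast hN
  rw [Nat.cast_sub hk]
  unfold magAt; field_simp; ring

lemma exp_nat_mul_log {x : ℝ} (hx : 0 ≤ x) {n : ℕ} (h : x = 0 → n = 0) :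
    Real.exp (n * Real.log x) = x ^ n := by
  rcases hx.eq_or_lt with h0 | h0
  · simp [h h0.symm]
  · rw [mul_comm, Real.exp_mul, Real.exp_log h0, Real.rpow_natCast]

lemma exp_mul_binEnt_magAt {N : ℕ} (hN : N ≠ 0) {k : ℕ} (hk : k ≤ N) :
    Real.exp (N * binEnt (magAt N k)) =
      2 ^ N * ((k : ℝ) ^ k * ((N - k : ℕ) : ℝ) ^ (N - k)) / N ^ N := by
  have hN' : (N : ℝ) ≠ 0 := by exact_mod_cast hN
  have e : N * binEnt (magAt N k) = k * Real.log (2 * k / N) +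
      ((N - k : ℕ) : ℝ) * Real.log (2 * ((N - k : ℕ) : ℝ) / N) := by
    unfold binEnt
    rw [one_add_magAt hN, one_sub_magAt hN hk]
    field_simp
  rw [e, Real.exp_add, exp_nat_mul_log (by positivity) (by simp [hN]),
    exp_nat_mul_log (by positivity) (by simp [hN])]
  obtain ⟨j, rfl⟩ := Nat.exists_eq_add_of_le hk
  rw [Nat.add_sub_cancel_left]
  simp only [div_pow, mul_pow, pow_add]
  field_simp

lemma levelWeight_eq (p : ℕ) (β h M : ℝ) {N : ℕ} (hN : N ≠ 0) {k : ℕ} (hk : k ≤ N) :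
    levelWeight p β h M N k =
      N.choose k * ((k : ℝ) ^ k * ((N - k : ℕ) : ℝ) ^ (N - k)) / N ^ N *
        Real.exp (N * (Hfun p β h (magAt N k) - M)) := by
  have hN' : (N : ℝ) ≠ 0 := by exact_mod_cast hN
  have e : (N : ℝ) * (Hfun p β h (magAt N k) - M) =
      N * (β * magAt N k ^ p + h * magAt N k) - N * M - N * binEnt (magAt N k) := by
    unfold Hfun; ring
  have hpow : ∀ n : ℕ, (n : ℝ) ^ n ≠ 0 := by
    intro n
    rcases Nat.eq_zero_or_pos n with rfl | hn
    · simp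
    · positivity
  have h1 := hpow k
  have h2 := hpow (N - k)
  rw [e, Real.exp_sub (N * (β * magAt N k ^ p + h * magAt N k) - N * M),
    exp_mul_binEnt_magAt hN hk, levelWeight]
  field_simp

lemma levelWeight_nonneg (p : ℕ) (β h M : ℝ) (N k : ℕ) : 0 ≤ levelWeight p β h M N k := by
  unfold levelWeight; positivity

lemma levelWeight_le_exp (p : ℕ) (β h M : ℝ) {N : ℕ} (hN : N ≠ 0) {k : ℕ} (hk : k ≤ N) :
    levelWeight p β h M N k ≤ Real.exp (N * (Hfun p β h (magAt N k) - M)) := by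
  rw [levelWeight_eq p β h M hN hk]
  refine mul_le_of_le_one_left (Real.exp_pos _).le ?_
  have hN' : (0 : ℝ) < N := by exact_mod_cast Nat.pos_of_ne_zero hN
  rw [div_le_one (by positivity)]
  have h := add_pow (k : ℝ) ((N - k : ℕ) : ℝ) N
  have e : (k : ℝ) + ((N - k : ℕ) : ℝ) = N := by rw [Nat.cast_sub hk]; ring
  rw [e] at h
  rw [h]
  have := Finset.single_le_sum (f := fun m => (k : ℝ) ^ m * ((N - k : ℕ) : ℝ) ^ (N - m) *
    (N.choose m : ℝ)) (fun m _ => by positivity) (Finset.mem_range.2 (Nat.lt_succ_of_le hk))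
  refine le_trans (le_of_eq ?_) this
  ring

lemma factorial_eq_stirlingSeq (n : ℕ) (hn : n ≠ 0) :
    (n.factorial : ℝ) = Stirling.stirlingSeq n * (√(2 * n) * (n / Real.exp 1) ^ n) := by
  have : (0 : ℝ) < n := by exact_mod_cast Nat.pos_of_ne_zero hn
  rw [Stirling.stirlingSeq, div_mul_cancel₀]
  positivity

/-- Stirling's formula for the level weights, as an exact identity. -/
lemma sqrt_mul_levelWeight (p : ℕ) (β h M : ℝ) {N k : ℕ} (hk0 : k ≠ 0) (hk : k < N) :
    √N * levelWeight p β h M N k =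
      Stirling.stirlingSeq N / (Stirling.stirlingSeq k * Stirling.stirlingSeq (N - k)) *
        √(2 / (1 - magAt N k ^ 2)) * Real.exp (N * (Hfun p β h (magAt N k) - M)) := by
  have hN : N ≠ 0 := by omega
  have hj : N - k ≠ 0 := by omega
  rw [levelWeight_eq p β h M hN hk.le, ← mul_assoc]
  congr 1
  have e1 : 1 - magAt N k ^ 2 = (2 * k / N) * (2 * ((N - k : ℕ) : ℝ) / N) := by
    rw [← one_add_magAt hN, ← one_sub_magAt hN hk.le]; ring
  rw [e1, Nat.cast_choose ℝ hk.le, factorial_eq_stirlingSeq N hN, factorial_eq_stirlingSeq k hk0,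
    factorial_eq_stirlingSeq (N - k) hj]
  obtain ⟨j, rfl⟩ := Nat.exists_eq_add_of_le hk.le
  rw [Nat.add_sub_cancel_left] at hj ⊢
  have s1 : Stirling.stirlingSeq k ≠ 0 :=
    (lt_of_lt_of_le (by positivity) (Stirling.sqrt_pi_le_stirlingSeq hk0)).ne'
  have s2 : Stirling.stirlingSeq j ≠ 0 :=
    (lt_of_lt_of_le (by positivity) (Stirling.sqrt_pi_le_stirlingSeq hj)).ne'
  have hkr : (0 : ℝ) < k := by exact_mod_cast Nat.pos_of_ne_zero hk0
  have hjr : (0 : ℝ) < j := by exact_mod_cast Nat.pos_of_ne_zero hj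
  have hNr : (0 : ℝ) < ((k + j : ℕ) : ℝ) := by exact_mod_cast Nat.pos_of_ne_zero hN
  have hs : √((k + j : ℕ) : ℝ) * √(2 * ((k + j : ℕ) : ℝ)) / (√(2 * k) * √(2 * j)) =
      √(2 / (2 * k / ((k + j : ℕ) : ℝ) * (2 * j / ((k + j : ℕ) : ℝ)))) := by
    rw [← Real.sqrt_mul (by positivity), ← Real.sqrt_mul (by positivity),
      ← Real.sqrt_div (by positivity)]
    congr 1
    field_simp
  rw [← hs]
  simp only [div_pow, pow_add]
  field_simp

/-- Second-order Taylor expansion of `Hfun` at a critical point. -/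
lemma eventually_abs_Hfun_sub_le (p : ℕ) {β h m : ℝ} (hm : m ∈ Set.Ioo (-1 : ℝ) 1)
    (h0 : Hderiv p β h m = 0) {ε : ℝ} (hε : 0 < ε) :
    ∀ᶠ y in 𝓝 m, |Hfun p β h y - Hfun p β h m - Hderiv2 p β m / 2 * (y - m) ^ 2| ≤
      ε * (y - m) ^ 2 := by
  have h1 := (hasDerivAt_iff_isLittleO.1 (hasDerivAt_Hderiv p β h hm)).def hε
  obtain ⟨δ, hδ, hb⟩ := Metric.eventually_nhds_iff_ball.1 (h1.and (isOpen_Ioo.mem_nhds hm))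
  filter_upwards [Metric.ball_mem_nhds m hδ] with y hy
  have hsub : ∀ z ∈ segment ℝ m y, z ∈ Metric.ball m δ ∧ |z - m| ≤ |y - m| := by
    intro z hz
    refine ⟨(convex_ball m δ).segment_subset (Metric.mem_ball_self hδ) hy hz, ?_⟩
    have := norm_sub_le_of_mem_segment hz
    simpa using this
  have hmv := (convex_segment m y).norm_image_sub_le_of_norm_hasDerivWithin_le
    (f := fun z => Hfun p β h z - Hderiv2 p β m / 2 * (z - m) ^ 2)
    (f' := fun z => Hderiv p β h z - Hderiv2 p β m * (z - m)) (C := ε * |y - m|)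
    (fun z hz => ?_) (fun z hz => ?_) (left_mem_segment ℝ m y) (right_mem_segment ℝ m y)
  · simp only [sub_self, Real.norm_eq_abs] at hmv
    rw [mul_assoc, abs_mul_abs_self] at hmv
    convert hmv using 2 <;> ring
  · have hz' := (hb z (hsub z hz).1).2
    have d2 : HasDerivAt (fun z : ℝ => (z - m) ^ 2) (2 * (z - m)) z := by
      exact (((hasDerivAt_id z).sub_const m).pow 2).congr_deriv (by simp)
    refine HasDerivAt.hasDerivWithinAt ?_
    refine ((hasDerivAt_Hfun p β h hz').sub (d2.const_mul (Hderiv2 p β m / 2))).congr_deriv ?_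
    ring
  · have hz1 := (hb z (hsub z hz).1).1
    rw [h0, sub_zero, smul_eq_mul] at hz1
    have e : Hderiv p β h z - Hderiv2 p β m * (z - m) =
      Hderiv p β h z - (z - m) * Hderiv2 p β m := by ring
    rw [e]
    refine hz1.trans ?_
    rw [Real.norm_eq_abs]
    exact mul_le_mul_of_nonneg_left (hsub z hz).2 hε.le

lemma tendsto_mul_Hfun_sub (p : ℕ) {β h m a : ℝ} (hm : m ∈ Set.Ioo (-1 : ℝ) 1)
    (h0 : Hderiv p β h m = 0) {y : ℕ → ℝ} (hy : Tendsto y atTop (𝓝 m))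
    (hya : Tendsto (fun N : ℕ => √N * (y N - m)) atTop (𝓝 a)) :
    Tendsto (fun N : ℕ => N * (Hfun p β h (y N) - Hfun p β h m)) atTop
      (𝓝 (Hderiv2 p β m / 2 * a ^ 2)) := by
  have hsq : ∀ N : ℕ, (√N * (y N - m)) ^ 2 = N * (y N - m) ^ 2 := fun N => by
    rw [mul_pow, Real.sq_sqrt (Nat.cast_nonneg N)]
  have hmain : Tendsto (fun N : ℕ => Hderiv2 p β m / 2 * (√N * (y N - m)) ^ 2) atTop
      (𝓝 (Hderiv2 p β m / 2 * a ^ 2)) := (hya.pow 2).const_mul _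
  have herr : Tendsto (fun N : ℕ => N * (Hfun p β h (y N) - Hfun p β h m) -
      Hderiv2 p β m / 2 * (√N * (y N - m)) ^ 2) atTop (𝓝 0) := by
    rw [Metric.tendsto_atTop']
    have hbd : ∀ᶠ N : ℕ in atTop, (√N * (y N - m)) ^ 2 < a ^ 2 + 1 :=
      (hya.pow 2).eventually (gt_mem_nhds (lt_add_one _))
    intro ε hε
    have hε' : 0 < ε / (a ^ 2 + 1) := by positivity
    obtain ⟨N₀, hN₀⟩ := eventually_atTop.1
      (hbd.and (hy.eventually (eventually_abs_Hfun_sub_le p hm h0 hε')))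
    refine ⟨N₀, fun N hN => ?_⟩
    obtain ⟨h1, h2⟩ := hN₀ N hN.le
    rw [Real.dist_eq, sub_zero]
    have e : N * (Hfun p β h (y N) - Hfun p β h m) -
      Hderiv2 p β m / 2 * (√N * (y N - m)) ^ 2 =
      N * (Hfun p β h (y N) - Hfun p β h m - Hderiv2 p β m / 2 * (y N - m) ^ 2) := by
      rw [hsq]; ring
    rw [e, abs_mul, abs_of_nonneg (Nat.cast_nonneg N)]
    calc (N : ℝ) * |_| ≤ N * (ε / (a ^ 2 + 1) * (y N - m) ^ 2) :=
          mul_le_mul_of_nonneg_left h2 (Nat.cast_nonneg N)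
      _ = ε / (a ^ 2 + 1) * (√N * (y N - m)) ^ 2 := by rw [hsq]; ring
      _ < ε / (a ^ 2 + 1) * (a ^ 2 + 1) := mul_lt_mul_of_pos_left h1 hε'
      _ = ε := by field_simp
  have := herr.add hmain
  simpa using this

/-- A finite sum as an integral of a step function on the line. -/
lemma integral_comp_floor (F : ℕ → ℝ) (n : ℕ) (h0 : F 0 = 0) (hn : ∀ k, n ≤ k → F k = 0) :
    ∫ y : ℝ, F ⌊y⌋₊ = ∑ k ∈ Finset.range n, F k := by
  have e : ∀ y : ℝ, F ⌊y⌋₊ = ∑ k ∈ Finset.range n,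
      (Set.Ico (k : ℝ) (k + 1)).indicator (fun _ => F k) y := by
    intro y
    rcases lt_or_ge y 0 with hy | hy
    · rw [Nat.floor_of_nonpos hy.le, h0]
      refine (Finset.sum_eq_zero fun k _ => Set.indicator_of_notMem (fun hk => ?_) _).symm
      exact absurd (hy.trans_le (Nat.cast_nonneg k)) (not_lt.2 hk.1)
    · have hmem : ∀ k : ℕ, y ∈ Set.Ico (k : ℝ) (k + 1) ↔ ⌊y⌋₊ = k := fun k =>
        (Nat.floor_eq_iff hy).symm
      simp only [Set.indicator_apply, hmem]
      rw [Finset.sum_ite_eq]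
      split_ifs with hk
      · rfl
      · exact hn _ (by simpa using hk)
  simp only [e]
  rw [integral_finsetSum]
  · refine Finset.sum_congr rfl fun k _ => ?_
    rw [integral_indicator measurableSet_Ico, setIntegral_const]
    simp [Measure.real]
  · intro k _
    exact (integrable_indicator_iff measurableSet_Ico).2
      (integrableOn_const (by simp))

lemma sum_eq_sqrt_mul_integral (F : ℕ → ℝ) (n : ℕ) (h0 : F 0 = 0) (hn : ∀ k, n ≤ k → F k = 0)
    {s : ℝ} (hs : 0 < s) (c : ℝ) :
    ∑ k ∈ Finset.range n, F k = ∫ t : ℝ, s * F ⌊c + s * t⌋₊ := by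
  rw [← integral_comp_floor F n h0 hn, integral_const_mul,
    Measure.integral_comp_mul_left (fun y => F ⌊c + y⌋₊) s,
    integral_add_left_eq_self (fun y => F ⌊y⌋₊) c, abs_of_pos (inv_pos.2 hs), smul_eq_mul,
    mul_inv_cancel_left₀ hs.ne']

lemma sqrt_mul_magAt_floor_sub {N : ℕ} (hN : N ≠ 0) (m t : ℝ) :
    √N * (magAt N ⌊N * (1 + m) / 2 + √N * t⌋₊ - m) =
      2 * t - 2 * (N * (1 + m) / 2 + √N * t - ⌊N * (1 + m) / 2 + √N * t⌋₊) / √N := by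
  have hN' : (0 : ℝ) < N := by exact_mod_cast Nat.pos_of_ne_zero hN
  have hs : 0 < √(N : ℝ) := Real.sqrt_pos.2 hN'
  have hsq : √(N : ℝ) * √N = N := Real.mul_self_sqrt hN'.le
  set k : ℝ := (⌊N * (1 + m) / 2 + √N * t⌋₊ : ℝ) with hk
  rw [magAt, ← hk, eq_sub_iff_add_eq]
  have e : ((2 * k - N) / N - m) = (2 * k - N - N * m) / N := by field_simp
  rw [e]
  have e2 : √(N : ℝ) * ((2 * k - N - N * m) / N) = (2 * k - N - N * m) / √N := by
    rw [mul_div_assoc', div_eq_div_iff hN'.ne' hs.ne']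
    linear_combination (2 * k - N - N * m) * hsq
  rw [e2, ← add_div, div_eq_iff hs.ne']
  ring

section LocalLimit

variable {m : ℝ} (t : ℝ)

lemma tendsto_sqrt_natCast_atTop : Tendsto (fun N : ℕ => √(N : ℝ)) atTop atTop :=
  Real.tendsto_sqrt_atTop.comp tendsto_natCast_atTop_atTop

lemma tendsto_center_atTop (hm : -1 < m) :
    Tendsto (fun N : ℕ => N * (1 + m) / 2 + √N * t) atTop atTop := by
  have h1 : Tendsto (fun N : ℕ => √(N : ℝ) * ((1 + m) / 2) + t) atTop atTop :=
    tendsto_atTop_add_const_right _ _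
      (tendsto_sqrt_natCast_atTop.atTop_mul_const (by linarith))
  refine (tendsto_sqrt_natCast_atTop.atTop_mul_atTop₀ h1).congr fun N => ?_
  have hsq : √(N : ℝ) * √N = N := Real.mul_self_sqrt (Nat.cast_nonneg N)
  linear_combination ((1 + m) / 2) * hsq

lemma tendsto_sqrt_mul_magAt_sub (hm : -1 < m) :
    Tendsto (fun N : ℕ => √N * (magAt N ⌊N * (1 + m) / 2 + √N * t⌋₊ - m)) atTop
      (𝓝 (2 * t)) := by
  have h0 : Tendsto (fun N : ℕ =>
      2 * (N * (1 + m) / 2 + √N * t - ⌊N * (1 + m) / 2 + √N * t⌋₊) / √N) atTop (𝓝 0) := by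
    refine squeeze_zero' (g := fun N : ℕ => 2 / √(N : ℝ)) ?_ ?_
      (tendsto_sqrt_natCast_atTop.const_div_atTop 2)
    · filter_upwards [(tendsto_center_atTop t hm).eventually_ge_atTop 0] with N hN
      have := Nat.floor_le hN
      exact div_nonneg (by linarith) (Real.sqrt_nonneg _)
    · filter_upwards with N
      have := Nat.lt_floor_add_one (N * (1 + m) / 2 + √N * t)
      exact div_le_div_of_nonneg_right (by linarith) (Real.sqrt_nonneg _)
  have := h0.const_sub (2 * t)
  rw [sub_zero] at this
  refine this.congr' ?_
  filter_upwards [eventually_ne_atTop 0] with N hN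
  exact (sqrt_mul_magAt_floor_sub hN m t).symm

lemma tendsto_magAt_floor (hm : -1 < m) :
    Tendsto (fun N : ℕ => magAt N ⌊N * (1 + m) / 2 + √N * t⌋₊) atTop (𝓝 m) := by
  have h1 := (tendsto_sqrt_mul_magAt_sub t hm).div_atTop tendsto_sqrt_natCast_atTop
  have h2 := h1.add_const m
  rw [zero_add] at h2
  refine h2.congr' ?_
  filter_upwards [eventually_gt_atTop 0] with N hN
  have hs : √(N : ℝ) ≠ 0 := (Real.sqrt_pos.2 (by exact_mod_cast hN)).ne'
  rw [mul_div_cancel_left₀ _ hs]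
  ring

lemma pos_and_lt_of_magAt_mem {N k : ℕ} (hN : N ≠ 0) (h : magAt N k ∈ Set.Ioo (-1 : ℝ) 1) :
    k ≠ 0 ∧ k < N := by
  have hN' : (0 : ℝ) < N := by exact_mod_cast Nat.pos_of_ne_zero hN
  obtain ⟨h1, h2⟩ := h
  constructor
  · rintro rfl
    have := one_add_magAt hN 0
    simp at this
    linarith
  · rw [magAt, div_lt_one hN'] at h2
    exact_mod_cast (by linarith : (k : ℝ) < N)

lemma tendsto_sqrt_mul_levelWeight (p : ℕ) {β h : ℝ} (hm : m ∈ Set.Ioo (-1 : ℝ) 1)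
    (h0 : Hderiv p β h m = 0) :
    Tendsto (fun N : ℕ => √N * levelWeight p β h (Hfun p β h m) N ⌊N * (1 + m) / 2 + √N * t⌋₊)
      atTop (𝓝 (√π / (√π * √π) * √(2 / (1 - m ^ 2)) *
        Real.exp (Hderiv2 p β m / 2 * (2 * t) ^ 2))) := by
  have hmag := tendsto_magAt_floor t hm.1
  have hk : Tendsto (fun N : ℕ => ⌊N * (1 + m) / 2 + √N * t⌋₊) atTop atTop :=
    tendsto_nat_floor_atTop.comp (tendsto_center_atTop t hm.1)
  have hin : ∀ᶠ N : ℕ in atTop, ⌊N * (1 + m) / 2 + √N * t⌋₊ ≠ 0 ∧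
      ⌊N * (1 + m) / 2 + √N * t⌋₊ < N := by
    filter_upwards [hmag.eventually (isOpen_Ioo.mem_nhds hm), eventually_ne_atTop 0] with N h1 h2
    exact pos_and_lt_of_magAt_mem h2 h1
  have hj : Tendsto (fun N : ℕ => N - ⌊N * (1 + m) / 2 + √N * t⌋₊) atTop atTop := by
    rw [← tendsto_natCast_atTop_iff (R := ℝ)]
    have h1 : Tendsto (fun N : ℕ => (N : ℝ) *
        ((1 - magAt N ⌊N * (1 + m) / 2 + √N * t⌋₊) / 2)) atTop atTop :=
      tendsto_natCast_atTop_atTop.atTop_mul_pos (by linarith [hm.2] : 0 < (1 - m) / 2)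
        ((hmag.const_sub 1).div_const 2)
    refine h1.congr' ?_
    filter_upwards [hin, eventually_ne_atTop 0] with N h2 hN
    have hN' : (N : ℝ) ≠ 0 := by exact_mod_cast hN
    rw [one_sub_magAt hN h2.2.le]
    field_simp
  have hpi : √π ≠ 0 := (Real.sqrt_pos.2 Real.pi_pos).ne'
  have hS := Stirling.tendsto_stirlingSeq_sqrt_pi
  have h1 := hS.div ((hS.comp hk).mul (hS.comp hj)) (mul_ne_zero hpi hpi)
  have hm2 : 1 - m ^ 2 ≠ 0 := by nlinarith [hm.1, hm.2]
  have h2 := ((tendsto_const_nhds (x := (2 : ℝ))).div ((hmag.pow 2).const_sub 1) hm2).sqrt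
  have h3 := (tendsto_mul_Hfun_sub p hm h0 hmag (tendsto_sqrt_mul_magAt_sub t hm.1)).rexp
  refine ((h1.mul h2).mul h3).congr' ?_
  filter_upwards [hin] with N hN
  exact (sqrt_mul_levelWeight p β h _ hN.1 hN.2).symm

end LocalLimit

lemma stirlingSeq_le_stirlingSeq_one {n : ℕ} (hn : n ≠ 0) :
    Stirling.stirlingSeq n ≤ Stirling.stirlingSeq 1 := by
  obtain ⟨k, rfl⟩ := Nat.exists_eq_succ_of_ne_zero hn
  exact Stirling.stirlingSeq'_antitone (Nat.zero_le k)

lemma gaussian_constant {m d : ℝ} (hm : m ∈ Set.Ioo (-1 : ℝ) 1) (hd : d < 0) :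
    ∫ t : ℝ, √π / (√π * √π) * √(2 / (1 - m ^ 2)) * Real.exp (d / 2 * (2 * t) ^ 2) =
      ((m ^ 2 - 1) * d) ^ (-(1 : ℝ) / 2) := by
  have e : ∀ t : ℝ, d / 2 * (2 * t) ^ 2 = -(-2 * d) * t ^ 2 := fun t => by ring
  have hpi := Real.pi_pos
  have hm2 : 0 < 1 - m ^ 2 := by nlinarith [hm.1, hm.2]
  have hd' : 0 < -d := by linarith
  have hpos : 0 < (1 - m ^ 2) * -d := mul_pos hm2 hd'
  simp only [e]
  rw [integral_const_mul, integral_gaussian]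
  have e1 : (m ^ 2 - 1) * d = (1 - m ^ 2) * -d := by ring
  rw [e1, neg_div, Real.rpow_neg hpos.le, ← Real.sqrt_eq_rpow, ← Real.sqrt_inv, mul_assoc,
    div_mul_cancel_left₀ (Real.sqrt_pos.2 hpi).ne', ← Real.sqrt_inv,
    ← Real.sqrt_mul (by positivity), ← Real.sqrt_mul (by positivity)]
  congr 1
  field_simp

/-- Laplace asymptotics of the level weights near a nondegenerate maximizer. -/
lemma exists_tendsto_levelMass_ball (p : ℕ) {β h m : ℝ} (hm : m ∈ Set.Ioo (-1 : ℝ) 1)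
    (h0 : Hderiv p β h m = 0) (hd : Hderiv2 p β m < 0) :
    ∃ r > 0, ∀ δ, 0 < δ → δ ≤ r →
      Tendsto (fun N : ℕ => levelMass p β h (Hfun p β h m) N (Metric.ball m δ)) atTop
        (𝓝 (((m ^ 2 - 1) * Hderiv2 p β m) ^ (-(1 : ℝ) / 2))) := by
  set c : ℝ := -Hderiv2 p β m / 4 with hc
  have hc0 : 0 < c := by rw [hc]; linarith
  have hm2 : 0 < 1 - m ^ 2 := by nlinarith [hm.1, hm.2]
  have hcont : ∀ᶠ y in 𝓝 m, (1 - m ^ 2) / 2 < 1 - y ^ 2 :=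
    (by fun_prop : Continuous fun y : ℝ => 1 - y ^ 2).continuousAt.eventually
      (lt_mem_nhds (by linarith : (1 - m ^ 2) / 2 < 1 - m ^ 2))
  obtain ⟨r, hr, hball⟩ := Metric.eventually_nhds_iff_ball.1
    ((eventually_abs_Hfun_sub_le p hm h0 hc0).and (hcont.and (isOpen_Ioo.mem_nhds hm)))
  refine ⟨r, hr, fun δ hδ hδr => ?_⟩
  replace hball : ∀ y ∈ Metric.ball m δ, Hfun p β h y - Hfun p β h m ≤ -c * (y - m) ^ 2 ∧
      (1 - m ^ 2) / 2 < 1 - y ^ 2 ∧ y ∈ Set.Ioo (-1 : ℝ) 1 := by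
    intro y hy
    obtain ⟨h1, h2, h3⟩ := hball y (Metric.ball_subset_ball hδr hy)
    refine ⟨?_, h2, h3⟩
    have := (abs_le.1 h1).2
    have e : Hderiv2 p β m = -4 * c := by rw [hc]; ring
    rw [e] at this
    linarith
  set F : ℕ → ℕ → ℝ := fun N k => (Metric.ball m δ).indicator
    (fun _ => levelWeight p β h (Hfun p β h m) N k) (magAt N k) with hF
  set C : ℝ := Stirling.stirlingSeq 1 / (√π * √π) * √(2 / ((1 - m ^ 2) / 2)) with hC
  have hFint : ∀ᶠ N : ℕ in atTop, ∫ t : ℝ, √N * F N ⌊N * (1 + m) / 2 + √N * t⌋₊ =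
      levelMass p β h (Hfun p β h m) N (Metric.ball m δ) := by
    filter_upwards [eventually_ne_atTop 0] with N hN
    have hout : ∀ k, ¬ (k ≠ 0 ∧ k < N) → F N k = 0 := fun k hk =>
      Set.indicator_of_notMem
        (fun hmem => hk (pos_and_lt_of_magAt_mem hN (hball _ hmem).2.2)) _
    exact (sum_eq_sqrt_mul_integral (F N) (N + 1) (hout 0 (by simp))
      (fun k hk => hout k (by omega))
      (Real.sqrt_pos.2 (by exact_mod_cast Nat.pos_of_ne_zero hN)) _).symm
  rw [← gaussian_constant hm hd]
  refine Tendsto.congr' hFint ?_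
  refine tendsto_integral_filter_of_dominated_convergence
    (fun t => C * Real.exp (4 * c) * Real.exp (-(2 * c) * t ^ 2)) ?_ ?_ ?_ ?_
  · refine Eventually.of_forall fun N => Measurable.aestronglyMeasurable ?_
    have : Measurable fun t : ℝ => ⌊N * (1 + m) / 2 + √N * t⌋₊ :=
      Nat.measurable_floor.comp (by fun_prop)
    exact ((measurable_from_nat (f := F N)).comp this).const_mul _
  · filter_upwards [eventually_ne_atTop 0] with N hN
    refine Eventually.of_forall fun t => ?_
    have hrhs : 0 ≤ C * Real.exp (4 * c) * Real.exp (-(2 * c) * t ^ 2) := by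
      have : 0 ≤ Stirling.stirlingSeq 1 :=
        (Real.sqrt_nonneg π).trans (Stirling.sqrt_pi_le_stirlingSeq one_ne_zero)
      positivity
    set k := ⌊N * (1 + m) / 2 + √N * t⌋₊ with hk
    by_cases hmem : magAt N k ∈ Metric.ball m δ
    · obtain ⟨b1, b2, b3⟩ := hball _ hmem
      obtain ⟨hk0, hkN⟩ := pos_and_lt_of_magAt_mem hN b3
      have hNr : (1 : ℝ) ≤ N := by exact_mod_cast Nat.one_le_iff_ne_zero.2 hN
      have hs1 : 1 ≤ √(N : ℝ) := Real.one_le_sqrt.2 hNr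
      rw [hF]
      simp only [Set.indicator_of_mem hmem]
      rw [Real.norm_of_nonneg (mul_nonneg (Real.sqrt_nonneg _) (levelWeight_nonneg ..)),
        sqrt_mul_levelWeight p β h _ hk0 hkN, mul_assoc C]
      have i1 := Stirling.sqrt_pi_le_stirlingSeq hk0
      have i2 := Stirling.sqrt_pi_le_stirlingSeq (by omega : N - k ≠ 0)
      have i3 := stirlingSeq_le_stirlingSeq_one hN
      have i4 : 0 ≤ Stirling.stirlingSeq N :=
        (Real.sqrt_nonneg π).trans (Stirling.sqrt_pi_le_stirlingSeq hN)
      have hpi : 0 < √π := Real.sqrt_pos.2 Real.pi_pos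
      refine mul_le_mul ?_ ?_ (Real.exp_pos _).le ?_
      · rw [hC]
        have i5 := i4.trans i3
        have i6 := hpi.le.trans i1
        gcongr
      · rw [← Real.exp_add]
        refine Real.exp_le_exp.2 ?_
        have hfl : 0 ≤ N * (1 + m) / 2 + √N * t := by
          by_contra hneg
          exact hk0 (Nat.floor_of_nonpos (not_le.1 hneg).le)
        have f1 := Nat.floor_le hfl
        have f2 := Nat.lt_floor_add_one (N * (1 + m) / 2 + √N * t)
        have hu := sqrt_mul_magAt_floor_sub hN m t
        rw [← hk] at hu f1 f2
        set θ := (N * (1 + m) / 2 + √N * t - k) / √N with hθ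
        have hθ0 : 0 ≤ θ := div_nonneg (by linarith) (by linarith)
        have hθ1 : θ ≤ 1 := by
          rw [hθ, div_le_one (by linarith)]
          linarith
        rw [mul_div_assoc, ← hθ] at hu
        have hsq : (N : ℝ) * (magAt N k - m) ^ 2 = (2 * t - 2 * θ) ^ 2 := by
          rw [← hu, mul_pow, Real.sq_sqrt (by linarith)]
        have hlow : 2 * t ^ 2 - 4 ≤ (2 * t - 2 * θ) ^ 2 := by
          nlinarith [sq_nonneg (t - 2 * θ), mul_le_one₀ hθ1 hθ0 hθ1]
        calc (N : ℝ) * (Hfun p β h (magAt N k) - Hfun p β h m)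
            ≤ N * (-c * (magAt N k - m) ^ 2) := mul_le_mul_of_nonneg_left b1 (by linarith)
          _ = -c * (2 * t - 2 * θ) ^ 2 := by rw [← hsq]; ring
          _ ≤ -c * (2 * t ^ 2 - 4) := mul_le_mul_of_nonpos_left hlow (by linarith)
          _ = _ := by ring
      · have : 0 ≤ Stirling.stirlingSeq 1 := i4.trans i3
        positivity
    · simp only [hF, Set.indicator_of_notMem hmem, mul_zero, norm_zero]
      exact hrhs
  · exact (integrable_exp_neg_mul_sq (by linarith)).const_mul _
  · refine Eventually.of_forall fun t => ?_
    refine (tendsto_sqrt_mul_levelWeight t p hm h0).congr' ?_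
    filter_upwards [(tendsto_magAt_floor t hm.1).eventually (Metric.ball_mem_nhds m hδ)] with N hN
    have hN' : magAt N ⌊N * (1 + m) / 2 + √N * t⌋₊ ∈ Metric.ball m δ := hN
    simp only [hF, Set.indicator_of_mem hN']

/-- The levels staying away from the maximizers carry no mass in the limit. -/
lemma tendsto_levelMass_zero {p : ℕ} {β h m : ℝ} (hβ : 0 < β) (hh : 0 < h)
    (hm : isMaximizer p β h m) {T : Set ℝ} (hT : IsClosed T)
    (hno : ∀ y ∈ T, ¬ isMaximizer p β h y) :
    Tendsto (fun N : ℕ => levelMass p β h (Hfun p β h m) N T) atTop (𝓝 0) := by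
  have hη : ∃ η > 0, ∀ y ∈ T, y ∈ Set.Icc (-1 : ℝ) 1 → Hfun p β h y - Hfun p β h m ≤ -η := by
    rcases (Set.Icc (-1 : ℝ) 1 ∩ T).eq_empty_or_nonempty with he | hne
    · exact ⟨1, one_pos, fun y hy hy' => absurd (he ▸ ⟨hy', hy⟩ : y ∈ (∅ : Set ℝ)) (by simp)⟩
    · obtain ⟨y₀, hy₀, hmax⟩ := (isCompact_Icc.inter_right hT).exists_isMaxOn hne
        (continuous_Hfun p β h).continuousOn
      have hlt : Hfun p β h y₀ < Hfun p β h m := by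
        refine lt_of_le_of_ne (hm.2 y₀ hy₀.1) fun heq => hno y₀ hy₀.2 ?_
        exact isMaximizer_of_mem_Icc hβ hh hy₀.1 fun x hx => heq ▸ hm.2 x hx
      refine ⟨Hfun p β h m - Hfun p β h y₀, sub_pos.2 hlt, fun y hy hy' => ?_⟩
      have : Hfun p β h y ≤ Hfun p β h y₀ := hmax ⟨hy', hy⟩
      linarith
  obtain ⟨η, hη, hle⟩ := hη
  have hr1 : |Real.exp (-η)| < 1 := by
    rw [abs_of_pos (Real.exp_pos _)]
    exact Real.exp_lt_one_iff.2 (by linarith)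
  have hlim : Tendsto (fun N : ℕ => (N : ℝ) ^ 1 * Real.exp (-η) ^ N + Real.exp (-η) ^ N) atTop
      (𝓝 (0 + 0)) := (tendsto_pow_const_mul_const_pow_of_abs_lt_one 1 hr1).add
    (tendsto_pow_atTop_nhds_zero_of_abs_lt_one hr1)
  rw [add_zero] at hlim
  refine squeeze_zero' ?_ ?_ hlim
  · exact Eventually.of_forall fun N => Finset.sum_nonneg fun k _ =>
      Set.indicator_nonneg (fun _ _ => levelWeight_nonneg ..) _
  · filter_upwards [eventually_ne_atTop 0] with N hN
    have hb : ∀ k ∈ Finset.range (N + 1), T.indicator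
        (fun _ => levelWeight p β h (Hfun p β h m) N k) (magAt N k) ≤ Real.exp (-η) ^ N := by
      intro k hk
      have hkN : k ≤ N := Nat.lt_succ_iff.1 (Finset.mem_range.1 hk)
      by_cases hmem : magAt N k ∈ T
      · rw [Set.indicator_of_mem hmem]
        refine (levelWeight_le_exp p β h _ hN hkN).trans ?_
        rw [← Real.exp_nat_mul]
        refine Real.exp_le_exp.2 (mul_le_mul_of_nonneg_left (hle _ hmem ⟨?_, ?_⟩)
          (Nat.cast_nonneg N))
        · have := one_add_magAt hN k
          have : (0 : ℝ) ≤ 2 * k / N := by positivity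
          linarith
        · have := one_sub_magAt hN hkN
          have : (0 : ℝ) ≤ 2 * ((N - k : ℕ) : ℝ) / N := by positivity
          linarith
      · rw [Set.indicator_of_notMem hmem]
        positivity
    refine (Finset.sum_le_card_nsmul _ _ _ hb).trans (le_of_eq ?_)
    simp
    ring

lemma tendsto_levelMass {p : ℕ} {β h : ℝ} (hβ : 0 < β) (hh : 0 < h) {K : ℕ} {ms : Fin K → ℝ}
    (hinj : Function.Injective ms) (hK : 0 < K) (hmax : ∀ k, isMaximizer p β h (ms k))
    (hall : ∀ x, isMaximizer p β h x → ∃ k, ms k = x) (hneg : ∀ k, Hderiv2 p β (ms k) < 0)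
    {M : ℝ} (hM : ∀ k, Hfun p β h (ms k) = M) {S : Set ℝ} (hS : IsClosed S)
    (hfr : ∀ k, ms k ∈ S → S ∈ 𝓝 (ms k)) :
    Tendsto (fun N : ℕ => levelMass p β h M N S) atTop
      (𝓝 (∑ k, S.indicator
        (fun _ => (((ms k) ^ 2 - 1) * Hderiv2 p β (ms k)) ^ (-(1 : ℝ) / 2)) (ms k))) := by
  have hpos : ∀ r : ℝ, 0 < r → ∀ᶠ δ in 𝓝[>] (0 : ℝ), δ ≤ r := fun r hr =>
    nhdsWithin_le_nhds (eventually_le_nhds hr)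
  have hnbhd : ∀ {a : ℝ} {U : Set ℝ}, U ∈ 𝓝 a → ∀ᶠ δ in 𝓝[>] (0 : ℝ), Metric.ball a δ ⊆ U := by
    intro a U hU
    obtain ⟨r, hr, hrU⟩ := Metric.mem_nhds_iff.1 hU
    filter_upwards [hpos r hr] with δ hδ using (Metric.ball_subset_ball hδ).trans hrU
  have hloc : ∀ k, ∀ᶠ δ in 𝓝[>] (0 : ℝ),
      Tendsto (fun N : ℕ => levelMass p β h M N (Metric.ball (ms k) δ)) atTop
        (𝓝 (((ms k ^ 2 - 1) * Hderiv2 p β (ms k)) ^ (-(1 : ℝ) / 2))) := by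
    intro k
    obtain ⟨r, hr, hlim⟩ := exists_tendsto_levelMass_ball p (hmax k).1
      (Hderiv_eq_zero_of_isMaximizer (hmax k)) (hneg k)
    rw [hM] at hlim
    filter_upwards [hpos r hr, self_mem_nhdsWithin] with δ h1 h2 using hlim δ h2 h1
  have hin : ∀ k, ∀ᶠ δ in 𝓝[>] (0 : ℝ), ms k ∈ S → Metric.ball (ms k) δ ⊆ S := by
    intro k
    by_cases hk : ms k ∈ S
    · filter_upwards [hnbhd (hfr k hk)] with δ hδ _ using hδ
    · exact Eventually.of_forall fun δ h => absurd h hk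
  have hout : ∀ k, ∀ᶠ δ in 𝓝[>] (0 : ℝ), ms k ∉ S → Metric.ball (ms k) δ ⊆ Sᶜ := by
    intro k
    by_cases hk : ms k ∈ S
    · exact Eventually.of_forall fun δ h => absurd hk h
    · filter_upwards [hnbhd (hS.isOpen_compl.mem_nhds hk)] with δ hδ _ using hδ
  have hsep : ∀ k j, ∀ᶠ δ in 𝓝[>] (0 : ℝ), k ≠ j → δ + δ ≤ dist (ms k) (ms j) := by
    intro k j
    by_cases hkj : k = j
    · exact Eventually.of_forall fun δ h => absurd hkj h
    · have hd : 0 < dist (ms k) (ms j) := dist_pos.2 fun h => hkj (hinj h)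
      filter_upwards [hpos _ (half_pos hd)] with δ hδ _
      linarith
  obtain ⟨δ, hδ⟩ := ((eventually_all.2 hloc).and ((eventually_all.2 hin).and
    ((eventually_all.2 hout).and ((eventually_all.2 fun k => eventually_all.2 (hsep k)).and
      self_mem_nhdsWithin)))).exists
  obtain ⟨hloc', hin', hout', hsep', hδ0⟩ := hδ
  have hδ0 : 0 < δ := hδ0
  set T : Set ℝ := S ∩ (⋃ k, Metric.ball (ms k) δ)ᶜ with hT
  have hTc : IsClosed T := hS.inter (isOpen_iUnion fun k => Metric.isOpen_ball).isClosed_compl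
  have hTno : ∀ y ∈ T, ¬ isMaximizer p β h y := by
    rintro y ⟨-, hy⟩ hymax
    obtain ⟨k, rfl⟩ := hall y hymax
    exact hy (Set.mem_iUnion.2 ⟨k, Metric.mem_ball_self hδ0⟩)
  have hrest := tendsto_levelMass_zero hβ hh (hmax ⟨0, hK⟩) hTc hTno
  rw [hM] at hrest
  have hpt : ∀ (w v : ℝ), S.indicator (fun _ => w) v =
      ∑ k, S.indicator (fun _ => (Metric.ball (ms k) δ).indicator (fun _ => w) v) (ms k) +
        T.indicator (fun _ => w) v := by
    intro w v
    by_cases hv : ∃ k, v ∈ Metric.ball (ms k) δ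
    · obtain ⟨k, hk⟩ := hv
      have hvT : v ∉ T := fun h => h.2 (Set.mem_iUnion.2 ⟨k, hk⟩)
      rw [Set.indicator_of_notMem hvT, add_zero, Finset.sum_eq_single k]
      · rw [Set.indicator_of_mem hk]
        by_cases hkS : ms k ∈ S
        · rw [Set.indicator_of_mem hkS, Set.indicator_of_mem (hin' k hkS hk)]
        · rw [Set.indicator_of_notMem hkS, Set.indicator_of_notMem (hout' k hkS hk)]
      · intro j _ hjk
        have hvj : v ∉ Metric.ball (ms j) δ := fun hj =>
          Set.disjoint_left.1 (Metric.ball_disjoint_ball (hsep' j k hjk)) hj hk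
        simp [Set.indicator_of_notMem hvj]
      · simp
    · push Not at hv
      have hvT : v ∈ T ↔ v ∈ S := by simpa [hT] using fun _ k => by simpa using hv k
      simp only [Set.indicator_of_notMem (hv _), Set.indicator_zero, Finset.sum_const_zero,
        zero_add]
      by_cases hvS : v ∈ S
      · rw [Set.indicator_of_mem hvS, Set.indicator_of_mem (hvT.2 hvS)]
      · rw [Set.indicator_of_notMem hvS, Set.indicator_of_notMem fun h => hvS (hvT.1 h)]
  have hsplit : ∀ N : ℕ, levelMass p β h M N S =
      ∑ k, S.indicator (fun _ => levelMass p β h M N (Metric.ball (ms k) δ)) (ms k) +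
        levelMass p β h M N T := by
    intro N
    have hk : ∀ k, S.indicator (fun _ => levelMass p β h M N (Metric.ball (ms k) δ)) (ms k) =
        ∑ j ∈ Finset.range (N + 1), S.indicator (fun _ => (Metric.ball (ms k) δ).indicator
          (fun _ => levelWeight p β h M N j) (magAt N j)) (ms k) := by
      intro k
      by_cases hkS : ms k ∈ S
      · simp only [Set.indicator_of_mem hkS, levelMass]
      · simp only [Set.indicator_of_notMem hkS, Finset.sum_const_zero]
    simp only [hk]
    rw [Finset.sum_comm]
    unfold levelMass
    rw [← Finset.sum_add_distrib]
    exact Finset.sum_congr rfl fun j _ => hpt _ _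
  simp only [hsplit]
  have hsum := tendsto_finsetSum Finset.univ (f := fun k (N : ℕ) =>
      S.indicator (fun _ => levelMass p β h M N (Metric.ball (ms k) δ)) (ms k))
      (a := fun k => S.indicator
        (fun _ => (((ms k) ^ 2 - 1) * Hderiv2 p β (ms k)) ^ (-(1 : ℝ) / 2)) (ms k))
      (x := atTop) (fun k _ => ?_)
  · simpa using hsum.add hrest
  · by_cases hkS : ms k ∈ S
    · simpa only [Set.indicator_of_mem hkS] using hloc' k
    · simp only [Set.indicator_of_notMem hkS]
      exact tendsto_const_nhds

/-- **Law of the empirical magnetization at `p`-critical points.** -/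
theorem lln_critical
    (p : ℕ) (hp : 3 ≤ p) (β h : ℝ) (hβ : 0 < β) (hh : 0 < h)
    (hcrit : pCritical p β h)
    (K : ℕ) (ms : Fin K → ℝ) (hmono : StrictMono ms)
    (hmax : ∀ k, isMaximizer p β h (ms k))
    (hall : ∀ x, isMaximizer p β h x → ∃ k, ms k = x) :
    (K = 2 ∨ K = 3) ∧
    ∀ x : ℝ, x ∉ Set.range ms →
      Tendsto (fun N : ℕ => cwProb p N β h {σ | mag σ / N ≤ x})
        atTop
        (𝓝 (∑ k : Fin K,
          (((ms k) ^ 2 - 1) * iteratedDeriv 2 (Hfun p β h) (ms k)) ^ (-(1:ℝ)/2) /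
            (∑ i : Fin K,
              (((ms i) ^ 2 - 1) * iteratedDeriv 2 (Hfun p β h) (ms i)) ^ (-(1:ℝ)/2)) *
          (if ms k ≤ x then (1:ℝ) else 0))) := by
  have hinj := hmono.injective
  obtain ⟨a, b, hab, ha, hb⟩ := hcrit
  have hother : ∀ k, ∃ b, isMaximizer p β h b ∧ b ≠ ms k := by
    intro k
    by_cases hak : a = ms k
    · exact ⟨b, hb, fun hbk => hab (hak.trans hbk.symm)⟩
    · exact ⟨a, ha, hak⟩
  have hneg : ∀ k, Hderiv2 p β (ms k) < 0 := by
    intro k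
    obtain ⟨c, hc, hck⟩ := hother k
    rcases hck.lt_or_gt with hlt | hlt
    · exact (Hderiv2_neg_of_two_isMaximizer hp hβ hh hc (hmax k) hlt).2
    · exact (Hderiv2_neg_of_two_isMaximizer hp hβ hh (hmax k) hc hlt).1
  have hK2 : K = 2 := by
    obtain ⟨i, rfl⟩ := hall a ha
    obtain ⟨j, rfl⟩ := hall b hb
    have hij : (i : ℕ) ≠ j := fun hij => hab (congrArg ms (Fin.ext hij))
    have hle : K ≤ 2 := by
      by_contra hlt
      exact not_three_isMaximizer hp hβ hh (hmax ⟨0, by omega⟩) (hmax ⟨1, by omega⟩)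
        (hmax ⟨2, by omega⟩) (hmono (by simp [Fin.lt_def])) (hmono (by simp [Fin.lt_def]))
    omega
  refine ⟨Or.inl hK2, fun x hx => ?_⟩
  have hK : 0 < K := by omega
  have hM : ∀ k, Hfun p β h (ms k) = Hfun p β h (ms ⟨0, hK⟩) := fun k =>
    le_antisymm ((hmax _).2 _ (Set.Ioo_subset_Icc_self (hmax k).1))
      ((hmax k).2 _ (Set.Ioo_subset_Icc_self (hmax _).1))
  have hIic := tendsto_levelMass hβ hh hinj hK hmax hall hneg hM (S := Set.Iic x) isClosed_Iic
    (fun k hk => Iic_mem_nhds (lt_of_le_of_ne hk fun hkx => hx ⟨k, hkx⟩))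
  have huniv := tendsto_levelMass hβ hh hinj hK hmax hall hneg hM (S := Set.univ) isClosed_univ
    (fun _ _ => univ_mem)
  simp only [Set.indicator_univ] at huniv
  have hcpos : ∀ k, 0 < (((ms k) ^ 2 - 1) * Hderiv2 p β (ms k)) ^ (-(1 : ℝ) / 2) := by
    intro k
    refine Real.rpow_pos_of_pos (mul_pos_of_neg_of_neg ?_ (hneg k)) _
    nlinarith [(hmax k).1.1, (hmax k).1.2]
  have htot : 0 < ∑ k, (((ms k) ^ 2 - 1) * Hderiv2 p β (ms k)) ^ (-(1 : ℝ) / 2) :=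
    Finset.sum_pos (fun k _ => hcpos k) ⟨⟨0, hK⟩, Finset.mem_univ _⟩
  simp only [fun k => iteratedDeriv_two_Hfun p β h (hmax k).1]
  have hlim := (hIic.div huniv htot.ne').congr' (f₂ := fun N : ℕ =>
    cwProb p N β h {σ | mag σ / N ≤ x}) (by
      filter_upwards [eventually_ne_atTop 0] with N hN using (cwProb_eq_div p hN β h _ x).symm)
  convert hlim using 2
  rw [Finset.sum_div]
  refine Finset.sum_congr rfl fun k _ => ?_
  by_cases hk : ms k ≤ x
  · rw [Set.indicator_of_mem (Set.mem_Iic.2 hk), if_pos hk, mul_one]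
  · rw [Set.indicator_of_notMem (fun h => hk (Set.mem_Iic.1 h)), if_neg hk, mul_zero, zero_div]
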